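/- There is an absolute constant C > 0 such that for any set D, any subset F ⊂ B(D), and all n ∈ ℕ, the linear sampling numbers and Kolmogorov numbers satisfy g_{2n}^{lin}(F, B(D)) ≤ C √n · d_n(F, B(D)). -/

import Mathlib

open scoped ENNReal

/-- The `m`-th linear sampling number of a class `F ⊆ B(D)` with error measured in the
sup-norm of `B(D)` (here `B(D)` is modeled as `BoundedContinuousFunction D ℂ` for a type
`D` with the discrete topology): the infimum over `m` sampling points `x i ∈ D` and
functions `φ i ∈ B(D)` of the worst-case error `sup_{f ∈ F} ‖f - ∑ i, f (x i) • φ i‖_∞`,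
computed in `ℝ≥0∞`. -/
noncomputable def gLin {D : Type*} [TopologicalSpace D] [DiscreteTopology D]
    (m : ℕ) (F : Set (BoundedContinuousFunction D ℂ)) : ℝ≥0∞ :=
  ⨅ (x : Fin m → D) (φ : Fin m → BoundedContinuousFunction D ℂ),
    ⨆ f ∈ F, (‖f - ∑ i, f (x i) • φ i‖₊ : ℝ≥0∞)

/-- The `n`-th Kolmogorov number of a class `F ⊆ B(D)` in `B(D)`: the infimum over
`n`-dimensional subspaces `V ⊆ B(D)` of `sup_{f ∈ F} inf_{g ∈ V} ‖f - g‖_∞`,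
computed in `ℝ≥0∞`. -/
noncomputable def dKol {D : Type*} [TopologicalSpace D] [DiscreteTopology D]
    (n : ℕ) (F : Set (BoundedContinuousFunction D ℂ)) : ℝ≥0∞ :=
  ⨅ (V : Submodule ℂ (BoundedContinuousFunction D ℂ)) (_ : Module.finrank ℂ V = n),
    ⨆ f ∈ F, ⨅ g ∈ V, (‖f - g‖₊ : ℝ≥0∞)

open scoped Matrix in
/-- If the evaluations `v y` have no common nonzero annihilator, then `n ≤ m` suitable sampling
points make the Gram matrix nonsingular. -/
theorem exists_det_gram_ne_zero {D : Type*} {n m : ℕ} (hn : 1 ≤ n) (hnm : n ≤ m)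
    (v : D → Fin n → ℂ) (hv : ∀ c : Fin n → ℂ, (∀ y, v y ⬝ᵥ c = 0) → c = 0) :
    ∃ x : Fin m → D, ((Matrix.of (v ∘ x))ᴴ * Matrix.of (v ∘ x)).det ≠ 0 := by
  obtain ⟨b, hb, hspan, hli⟩ := exists_linearIndependent ℂ (Set.range v)
  have hfin : Finite b := hli.finite
  have : Fintype b := Fintype.ofFinite b
  have hcard : Fintype.card b ≤ n := by simpa using hli.fintype_card_le_finrank
  have hann : ∀ c : Fin n → ℂ, (∀ w ∈ b, w ⬝ᵥ c = 0) → c = 0 := by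
    intro c hc
    refine hv c fun y => ?_
    have hy : v y ∈ Submodule.span ℂ b := hspan ▸ Submodule.subset_span ⟨y, rfl⟩
    generalize v y = z at hy
    induction hy using Submodule.span_induction with
    | mem w hw => exact hc w hw
    | zero => simp
    | add w z _ _ hw hz => simp [add_dotProduct, hw, hz]
    | smul a w _ hw => simp [smul_dotProduct, hw]
  have hne : Nonempty b := by
    by_contra h
    have h1 := hann (fun _ => 1) fun w hw => (h ⟨⟨w, hw⟩⟩).elim
    exact one_ne_zero (congrFun h1 ⟨0, hn⟩)
  obtain ⟨e⟩ : Nonempty (b ↪ Fin m) :=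
    Function.Embedding.nonempty_of_card_le (by simpa using hcard.trans hnm)
  choose p hp using fun w : b => hb w.2
  refine ⟨p ∘ Function.invFun e, fun h => ?_⟩
  obtain ⟨c, hc, hc0⟩ := Matrix.exists_mulVec_eq_zero_iff.mpr h
  open scoped ComplexOrder in
  rw [Matrix.conjTranspose_mul_self_mulVec_eq_zero] at hc0
  refine hc (hann c fun w hw => ?_)
  have := congrFun hc0 (e ⟨w, hw⟩)
  simpa [Matrix.mulVec, Function.leftInverse_invFun e.injective _, hp] using this

open scoped Matrix in
/-- The rank-one determinant update. -/
theorem Matrix.det_add_vecMulVec_of_isUnit {ι R : Type*} [Fintype ι] [DecidableEq ι] [CommRing R]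
    {A : Matrix ι ι R} (hA : IsUnit A.det) (u w : ι → R) :
    (A + Matrix.vecMulVec u w).det = A.det * (1 + w ⬝ᵥ A⁻¹ *ᵥ u) := by
  rw [Matrix.vecMulVec_eq Unit, Matrix.det_add_replicateCol_mul_replicateRow hA, Matrix.mul_assoc]
  congr 1
  simp [Matrix.det_unique, Matrix.mul_apply, dotProduct, Matrix.mulVec]

open scoped Matrix in
/-- A Gram matrix is the sum of the rank-one matrices of its rows. -/
theorem gram_eq_sum {n m : ℕ} (B : Fin m → Fin n → ℂ) :
    (Matrix.of B)ᴴ * Matrix.of B = ∑ i, Matrix.vecMulVec (star (B i)) (B i) := by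
  ext k l
  simp [Matrix.mul_apply, Matrix.sum_apply, Matrix.vecMulVec_apply]

open scoped Matrix in
/-- Deleting one row at a time, the determinants of the Gram matrices add up to a multiple of the
determinant of the full Gram matrix. -/
theorem sum_det_gram_removeNth {n m : ℕ} (B : Fin (m + 1) → Fin n → ℂ)
    (hB : IsUnit ((Matrix.of B)ᴴ * Matrix.of B).det) :
    ∑ i : Fin (m + 1), ((Matrix.of (B ∘ i.succAbove))ᴴ * Matrix.of (B ∘ i.succAbove)).det
      = ((m : ℂ) + 1 - n) * ((Matrix.of B)ᴴ * Matrix.of B).det := by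
  set G := (Matrix.of B)ᴴ * Matrix.of B with hG
  have hrem (i : Fin (m + 1)) :
      ((Matrix.of (B ∘ i.succAbove))ᴴ * Matrix.of (B ∘ i.succAbove)).det
        = G.det * (1 - B i ⬝ᵥ G⁻¹ *ᵥ star (B i)) := by
    have h : (Matrix.of (B ∘ i.succAbove))ᴴ * Matrix.of (B ∘ i.succAbove)
        = G + Matrix.vecMulVec (-star (B i)) (B i) := by
      rw [hG, gram_eq_sum, gram_eq_sum, Fin.sum_univ_succAbove _ i]
      simp [Matrix.neg_vecMulVec]
    rw [h, Matrix.det_add_vecMulVec_of_isUnit hB, Matrix.mulVec_neg, dotProduct_neg,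
      sub_eq_add_neg]
  have htr : ∑ i, B i ⬝ᵥ G⁻¹ *ᵥ star (B i) = n := by
    have h : (G⁻¹ * G).trace = n := by simp [Matrix.nonsing_inv_mul G hB]
    nth_rewrite 2 [hG] at h
    rw [gram_eq_sum, Matrix.mul_sum, Matrix.trace_sum] at h
    simpa [Matrix.mul_vecMulVec, Matrix.trace_vecMulVec, dotProduct_comm] using h
  simp only [hrem, ← Finset.mul_sum, Finset.sum_sub_distrib, htr]
  simp
  ring

open scoped Matrix in
/-- The coefficients of the least squares estimator, in terms of the leverage score. -/
theorem sum_normSq_vecMul_gram_inv {n m : ℕ} (B : Matrix (Fin m) (Fin n) ℂ)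
    (hB : IsUnit (Bᴴ * B).det) (w : Fin n → ℂ) :
    ((∑ i, ‖(w ᵥ* ((Bᴴ * B)⁻¹ * Bᴴ)) i‖ ^ 2 : ℝ) : ℂ) = w ⬝ᵥ (Bᴴ * B)⁻¹ *ᵥ star w := by
  set a := w ᵥ* ((Bᴴ * B)⁻¹ * Bᴴ) with ha
  have h1 : ((∑ i, ‖a i‖ ^ 2 : ℝ) : ℂ) = a ⬝ᵥ star a := by
    simp [dotProduct, Complex.mul_conj, Complex.normSq_eq_norm_sq]
  have hH : ((Bᴴ * B)⁻¹)ᴴ = (Bᴴ * B)⁻¹ := by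
    rw [Matrix.conjTranspose_nonsing_inv]
    simp
  have h2 : star a = B *ᵥ (Bᴴ * B)⁻¹ *ᵥ star w := by
    rw [ha, Matrix.star_vecMul, Matrix.conjTranspose_mul, hH]
    simp
  rw [h1, h2, ha, ← Matrix.dotProduct_mulVec, Matrix.mulVec_mulVec, Matrix.mulVec_mulVec]
  congr 2
  rw [Matrix.mul_assoc _ Bᴴ B, Matrix.nonsing_inv_mul _ hB, Matrix.one_mul]

open scoped Matrix in
/-- Approximately D-optimal sampling points: the leverage scores are bounded everywhere. -/
theorem exists_leverage_le {D : Type*} {n : ℕ} (hn : 1 ≤ n) (v : D → Fin n → ℂ) (K : ℝ)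
    (hK : ∀ y k, ‖v y k‖ ≤ K)
    (hv : ∀ c : Fin n → ℂ, (∀ y, v y ⬝ᵥ c = 0) → c = 0) :
    ∃ x : Fin (2 * n) → D, IsUnit ((Matrix.of (v ∘ x))ᴴ * Matrix.of (v ∘ x)).det ∧
      ∀ y, ∑ i, ‖(v y ᵥ* (((Matrix.of (v ∘ x))ᴴ * Matrix.of (v ∘ x))⁻¹ *
        (Matrix.of (v ∘ x))ᴴ)) i‖ ^ 2 ≤ 3 := by
  set F : (Fin (2 * n) → D) → ℝ := fun x =>
    ‖((Matrix.of (v ∘ x))ᴴ * Matrix.of (v ∘ x)).det‖ with hF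
  have hbdd : BddAbove (Set.range F) := by
    refine ⟨n.factorial • ((2 * n : ℕ) * (K * K)) ^ n, ?_⟩
    rintro _ ⟨x, rfl⟩
    refine (Matrix.det_le (A := (Matrix.of (v ∘ x))ᴴ * Matrix.of (v ∘ x))
      (abv := NormedField.toAbsoluteValue ℂ) (x := (2 * n : ℕ) * (K * K))
      fun k l => ?_).trans_eq (by rw [Fintype.card_fin])
    change ‖((Matrix.of (v ∘ x))ᴴ * Matrix.of (v ∘ x)) k l‖ ≤ _
    rw [Matrix.mul_apply]
    refine (norm_sum_le _ _).trans ((Finset.sum_le_card_nsmul _ _ (K * K) fun i _ => ?_).trans ?_)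
    · simp only [Matrix.conjTranspose_apply, Matrix.of_apply, norm_mul, norm_star]
      exact mul_le_mul (hK _ _) (hK _ _) (norm_nonneg _) ((norm_nonneg _).trans (hK (x i) k))
    · simp
  obtain ⟨x₀, hx₀⟩ := exists_det_gram_ne_zero hn (show n ≤ 2 * n by omega) v hv
  have hpos : 0 < sSup (Set.range F) :=
    (norm_pos_iff.mpr hx₀).trans_le (le_csSup hbdd ⟨x₀, rfl⟩)
  obtain ⟨_, ⟨x, rfl⟩, hx⟩ := exists_lt_of_lt_csSup (Set.range_nonempty_iff_nonempty.mpr ⟨x₀⟩) (half_lt_self hpos)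
  have hmax (z) : F z ≤ 2 * F x := by linarith [le_csSup hbdd ⟨z, rfl⟩]
  have hFx : 0 < F x := by linarith
  have hG : IsUnit ((Matrix.of (v ∘ x))ᴴ * Matrix.of (v ∘ x)).det :=
    (norm_pos_iff.mp hFx).isUnit
  refine ⟨x, hG, fun y => ?_⟩
  set d := ∑ i, ‖(v y ᵥ* (((Matrix.of (v ∘ x))ᴴ * Matrix.of (v ∘ x))⁻¹ *
        (Matrix.of (v ∘ x))ᴴ)) i‖ ^ 2 with hd
  have hd0 : 0 ≤ d := by positivity
  set B : Fin (2 * n + 1) → Fin n → ℂ := v ∘ (Fin.cons y x : Fin (2 * n + 1) → D) with hB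
  have hdet : ((Matrix.of B)ᴴ * Matrix.of B).det
      = ((Matrix.of (v ∘ x))ᴴ * Matrix.of (v ∘ x)).det * ((1 + d : ℝ) : ℂ) := by
    rw [Complex.ofReal_add, hd, sum_normSq_vecMul_gram_inv _ hG, Complex.ofReal_one,
      ← Matrix.det_add_vecMulVec_of_isUnit hG, gram_eq_sum, gram_eq_sum, Fin.sum_univ_succ,
      add_comm]
    simp [hB]
  have hnorm : ‖((Matrix.of B)ᴴ * Matrix.of B).det‖ = F x * (1 + d) := by
    rw [hdet, norm_mul, Complex.norm_real, Real.norm_of_nonneg (by positivity)]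
  have hBu : IsUnit ((Matrix.of B)ᴴ * Matrix.of B).det := by
    refine (norm_pos_iff.mp ?_).isUnit
    rw [hnorm]
    positivity
  have hsum := congrArg norm (sum_det_gram_removeNth B hBu)
  have hle : ‖∑ i : Fin (2 * n + 1),
      ((Matrix.of (B ∘ i.succAbove))ᴴ * Matrix.of (B ∘ i.succAbove)).det‖
        ≤ (2 * n + 1) * (2 * F x) := by
    refine (norm_sum_le _ _).trans
      ((Finset.sum_le_card_nsmul _ _ (2 * F x) fun i _ => hmax _).trans ?_)
    simp
  have hcoef : ((2 * n : ℕ) : ℂ) + 1 - n = ((n + 1 : ℝ) : ℂ) := by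
    push_cast
    ring
  rw [hsum, norm_mul, hnorm, hcoef, Complex.norm_real, Real.norm_of_nonneg (by positivity)] at hle
  have hle' : ((n : ℝ) + 1) * (1 + d) ≤ (2 * n + 1) * 2 := by
    refine le_of_mul_le_mul_right ?_ hFx
    linarith
  have hn0 : (0 : ℝ) ≤ n := n.cast_nonneg
  nlinarith

open scoped Matrix in
/-- Every `n`-dimensional space of bounded functions admits a linear reconstruction from `2 n`
samples that is exact on the space and has norm at most `√(6 n)` in the uniform norm. -/
theorem exists_sampling_projection {D : Type*} [TopologicalSpace D] [DiscreteTopology D]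
    {n : ℕ} (hn : 1 ≤ n) (V : Submodule ℂ (BoundedContinuousFunction D ℂ))
    (hV : Module.finrank ℂ V = n) :
    ∃ (x : Fin (2 * n) → D) (φ : Fin (2 * n) → BoundedContinuousFunction D ℂ),
      (∀ g ∈ V, ∑ i, g (x i) • φ i = g) ∧
      ∀ f : BoundedContinuousFunction D ℂ, ‖∑ i, f (x i) • φ i‖ ≤ √(6 * n) * ‖f‖ := by
  have : Module.Finite ℂ V := Module.finite_of_finrank_pos (by omega)
  let b := Module.finBasisOfFinrankEq ℂ V hV
  let v : D → Fin n → ℂ := fun y k => (b k : BoundedContinuousFunction D ℂ) y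
  have hcomb (c : Fin n → ℂ) (y : D) :
      ((∑ k, c k • b k : V) : BoundedContinuousFunction D ℂ) y = v y ⬝ᵥ c := by
    simp [v, dotProduct, BoundedContinuousFunction.sum_apply, mul_comm]
  have hv (c : Fin n → ℂ) (hc : ∀ y, v y ⬝ᵥ c = 0) : c = 0 := by
    have h : ∑ k, c k • b k = 0 := by
      ext y
      rw [hcomb, hc]
      rfl
    exact funext (Fintype.linearIndependent_iff.mp b.linearIndependent c h)
  have hK (y : D) (k : Fin n) : ‖v y k‖ ≤ ∑ j, ‖b j‖ :=
    (BoundedContinuousFunction.norm_coe_le_norm _ y).trans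
      (Finset.single_le_sum (f := fun j => ‖b j‖) (fun j _ => norm_nonneg _) (Finset.mem_univ k))
  obtain ⟨x, hG, hx⟩ := exists_leverage_le hn v _ hK hv
  set B := Matrix.of (v ∘ x) with hB
  set P := (Bᴴ * B)⁻¹ * Bᴴ with hP
  let φ : Fin (2 * n) → BoundedContinuousFunction D ℂ := fun i => ((∑ k, P k i • b k : V))
  have hφ (f : Fin (2 * n) → ℂ) (y : D) : (∑ i, f i • φ i) y = (v y ᵥ* P) ⬝ᵥ f := by
    rw [BoundedContinuousFunction.sum_apply, dotProduct]
    refine Finset.sum_congr rfl fun i _ => ?_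
    rw [BoundedContinuousFunction.coe_smul]
    beta_reduce
    rw [hcomb, smul_eq_mul, mul_comm]
    rfl
  refine ⟨x, φ, fun g hg => ?_, fun f => ?_⟩
  · ext y
    obtain ⟨c, rfl⟩ : ∃ c : Fin n → ℂ, g = ((∑ k, c k • b k : V)) :=
      ⟨b.repr ⟨g, hg⟩, by rw [b.sum_repr]⟩
    have hs : (fun i => ((∑ k, c k • b k : V) : BoundedContinuousFunction D ℂ) (x i)) = B *ᵥ c :=
      funext fun i => hcomb c (x i)
    rw [hφ, hs, hcomb, ← Matrix.dotProduct_mulVec, Matrix.mulVec_mulVec, hP, Matrix.mul_assoc,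
      Matrix.nonsing_inv_mul _ hG, Matrix.one_mulVec]
  · refine (BoundedContinuousFunction.norm_le (by positivity)).mpr fun y => ?_
    rw [hφ]
    have hl1 : ∑ i, ‖(v y ᵥ* P) i‖ ≤ √(6 * n) := by
      refine Real.le_sqrt_of_sq_le (sq_sum_le_card_mul_sum_sq.trans ?_)
      have h := hx y
      simp only [Finset.card_univ, Fintype.card_fin]
      push_cast
      nlinarith [(n.cast_nonneg : (0 : ℝ) ≤ n)]
    calc ‖(v y ᵥ* P) ⬝ᵥ fun i => f (x i)‖ ≤ ∑ i, ‖(v y ᵥ* P) i‖ * ‖f‖ := by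
          refine (norm_sum_le _ _).trans (Finset.sum_le_sum fun i _ => ?_)
          rw [norm_mul]
          gcongr
          exact f.norm_coe_le_norm _
      _ ≤ √(6 * n) * ‖f‖ := by
          rw [← Finset.sum_mul]
          gcongr

/-- **Sampling numbers vs. Kolmogorov numbers in the uniform norm.**
There is an absolute constant `C > 0` such that for every set `D`, every class
`F ⊆ B(D)`, and every `n ≥ 1`, one has `g_{2n}^{lin}(F, B(D)) ≤ C √n · d_n(F, B(D))`. -/
theorem stmt12 :
    ∃ C : ℝ, 0 < C ∧
      ∀ (D : Type*) [TopologicalSpace D] [DiscreteTopology D]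
        (F : Set (BoundedContinuousFunction D ℂ)) (n : ℕ), 1 ≤ n →
        gLin (2 * n) F ≤ ENNReal.ofReal (C * Real.sqrt n) * dKol n F := by
  refine ⟨4, by norm_num, fun D _ _ F n hn => ?_⟩
  have hs1 : 1 ≤ √(n : ℝ) := Real.one_le_sqrt.mpr (by exact_mod_cast hn)
  have hc0 : ENNReal.ofReal (4 * √(n : ℝ)) ≠ 0 := by
    rw [Ne, ENNReal.ofReal_eq_zero, not_le]
    positivity
  have hct : ENNReal.ofReal (4 * √(n : ℝ)) ≠ ⊤ := ENNReal.ofReal_ne_top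
  rw [dKol, ENNReal.mul_iInf_of_ne hc0 hct]
  refine le_iInf fun V => ?_
  rw [ENNReal.mul_iInf_of_ne hc0 hct]
  refine le_iInf fun hV => ?_
  obtain ⟨x, φ, hexact, hbound⟩ := exists_sampling_projection hn V hV
  refine iInf₂_le_of_le x φ (iSup₂_le fun f hf => ?_)
  refine le_trans ?_ (mul_le_mul_right (le_iSup₂_of_le f hf le_rfl) _)
  rw [ENNReal.mul_iInf_of_ne hc0 hct]
  refine le_iInf fun g => ?_
  rw [ENNReal.mul_iInf_of_ne hc0 hct]
  refine le_iInf fun hg => ?_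
  have hdecomp : f - ∑ i, f (x i) • φ i = (f - g) - ∑ i, (f - g) (x i) • φ i := by
    simp only [BoundedContinuousFunction.coe_sub, Pi.sub_apply, sub_smul, Finset.sum_sub_distrib,
      hexact g hg]
    abel
  have h6 : √(6 * n : ℝ) ≤ 3 * √(n : ℝ) := by
    rw [Real.sqrt_mul (by norm_num)]
    gcongr
    exact Real.sqrt_le_iff.mpr (by norm_num)
  have hreal : ‖f - ∑ i, f (x i) • φ i‖ ≤ 4 * √(n : ℝ) * ‖f - g‖ := by
    rw [hdecomp]
    refine (norm_sub_le _ _).trans ?_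
    have := hbound (f - g)
    nlinarith [norm_nonneg (f - g)]
  rw [← enorm_eq_nnnorm, ← enorm_eq_nnnorm, ← ofReal_norm, ← ofReal_norm, ← ENNReal.ofReal_mul (by positivity)]
  exact ENNReal.ofReal_le_ofReal hreal
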